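/- Let T > 0 and 0 < δ < 1/4. There exists a constant C = C(T, δ) > 0 such that for all times 0 < s₁ < t₁ ≤ T, 0 < s₂ < t₂ ≤ T, all η₁, η₂, τ₁, τ₂ ∈ (0, 2T+2], and all points y₁, y₂, z₁, z₂ ∈ ℝ³, one has ∫_{ℝ³} ∫_{ℝ³} K_{t₁−s₁}(y₁,w₁) · K_{t₂−s₂}(y₂,w₂) · K_{η₁}(z₁,w₂) · K_{η₂}(z₂,w₁) · K_{τ₁}(w₁,w₂) · K_{τ₂}(w₁,w₂) dw₁ dw₂ ≤ C · (t₁−s₁)^{−3δ} · (t₂−s₂)^{−3δ} · η₁^{−3/2+δ} · η₂^{−3/2+3δ} · (τ₁·τ₂)^{−3/2+δ}. -/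

import Mathlib

open MeasureTheory Real

noncomputable section

/-- Mehler heat kernel of the harmonic oscillator `H = -Δ + |x|²` on `ℝ³`. -/
def mehlerK (t : ℝ) (x y : EuclideanSpace ℝ (Fin 3)) : ℝ :=
  (2 * π * Real.sinh (2 * t)) ^ (-(3 : ℝ) / 2) *
    Real.exp (-‖x - y‖ ^ 2 / (4 * Real.tanh t) - Real.tanh t * ‖x + y‖ ^ 2 / 4)

lemma Real.tanh_pos_of_pos {t : ℝ} (ht : 0 < t) : 0 < Real.tanh t := by
  rw [Real.tanh_eq_sinh_div_cosh]
  exact div_pos (Real.sinh_pos_iff.2 ht) (Real.cosh_pos t)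

lemma Real.tanh_le_self_of_nonneg {t : ℝ} (ht : 0 ≤ t) : Real.tanh t ≤ t := by
  rw [Real.tanh_eq_sinh_div_cosh, div_le_iff₀ (Real.cosh_pos t)]
  have hderiv (x : ℝ) : HasDerivAt (fun s ↦ s * Real.cosh s - Real.sinh s)
      (x * Real.sinh x) x := by
    refine (((hasDerivAt_id' x).mul (Real.hasDerivAt_cosh x)).sub
      (Real.hasDerivAt_sinh x)).congr_deriv ?_
    ring
  have hmono : MonotoneOn (fun s ↦ s * Real.cosh s - Real.sinh s) (Set.Ici 0) := by
    refine monotoneOn_of_hasDerivWithinAt_nonneg (convex_Ici 0)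
      (fun x _ ↦ (hderiv x).continuousAt.continuousWithinAt)
      (fun x _ ↦ (hderiv x).hasDerivWithinAt) fun x hx ↦ ?_
    have hx' : 0 < x := by simpa using hx
    exact mul_nonneg hx'.le (Real.sinh_nonneg_iff.2 hx'.le)
  have h := hmono (Set.mem_Ici.2 le_rfl) (Set.mem_Ici.2 ht) ht
  simp only [zero_mul, Real.sinh_zero, sub_zero] at h
  linarith

lemma mehlerK_nonneg {t : ℝ} (ht : 0 < t) (x y : EuclideanSpace ℝ (Fin 3)) :
    0 ≤ mehlerK t x y := by
  have : 0 < Real.sinh (2 * t) := Real.sinh_pos_iff.2 (by linarith)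
  unfold mehlerK
  positivity

/-- The Mehler kernel is dominated by the Euclidean heat kernel. -/
lemma mehlerK_le_heatKernel {t : ℝ} (ht : 0 < t) (x y : EuclideanSpace ℝ (Fin 3)) :
    mehlerK t x y ≤ (4 * π * t) ^ (-(3 : ℝ) / 2) * Real.exp (-(1 / (4 * t)) * ‖y - x‖ ^ 2) := by
  have hsinh : 2 * t ≤ Real.sinh (2 * t) := Real.self_le_sinh_iff.2 (by linarith)
  have htanh := Real.tanh_pos_of_pos ht
  unfold mehlerK
  gcongr ?_ * Real.exp ?_
  · refine Real.rpow_le_rpow_of_nonpos (by positivity) ?_ (by norm_num)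
    nlinarith [Real.pi_pos]
  · have h1 : ‖x - y‖ ^ 2 / (4 * t) ≤ ‖x - y‖ ^ 2 / (4 * Real.tanh t) := by
      gcongr
      exact Real.tanh_le_self_of_nonneg ht.le
    have h2 : 0 ≤ Real.tanh t * ‖x + y‖ ^ 2 / 4 := by positivity
    rw [norm_sub_rev y x, neg_div, neg_mul, one_div_mul_eq_div]
    linarith

lemma mehlerK_le_rpow {t : ℝ} (ht : 0 < t) (x y : EuclideanSpace ℝ (Fin 3)) :
    mehlerK t x y ≤ t ^ (-(3 : ℝ) / 2) := by
  refine (mehlerK_le_heatKernel ht x y).trans ?_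
  rw [← mul_one (t ^ (-(3 : ℝ) / 2))]
  gcongr ?_ * ?_
  · refine Real.rpow_le_rpow_of_nonpos ht ?_ (by norm_num)
    nlinarith [Real.pi_gt_three]
  · rw [Real.exp_le_one_iff, neg_mul, neg_nonpos]
    positivity

lemma integral_mehlerK_mul_le {t M : ℝ} (ht : 0 < t) (x : EuclideanSpace ℝ (Fin 3))
    {f : EuclideanSpace ℝ (Fin 3) → ℝ} (hf : ∀ w, 0 ≤ f w) (hfM : ∀ w, f w ≤ M) :
    ∫ w, mehlerK t x w * f w ≤ M := by
  have hb : 0 < 1 / (4 * t) := by positivity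
  have hval : ∫ w : EuclideanSpace ℝ (Fin 3), Real.exp (-(1 / (4 * t)) * ‖w - x‖ ^ 2) =
      (4 * π * t) ^ ((3 : ℝ) / 2) := by
    rw [integral_sub_right_eq_self (fun v : EuclideanSpace ℝ (Fin 3) ↦
      Real.exp (-(1 / (4 * t)) * ‖v‖ ^ 2)) x, GaussianFourier.integral_rexp_neg_mul_sq_norm hb]
    simp only [finrank_euclideanSpace, Fintype.card_fin, Nat.cast_ofNat]
    congr 1
    field_simp
  have hint : Integrable fun w : EuclideanSpace ℝ (Fin 3) ↦
      Real.exp (-(1 / (4 * t)) * ‖w - x‖ ^ 2) := by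
    by_contra h
    have hpos : 0 < (4 * π * t) ^ ((3 : ℝ) / 2) := by positivity
    exact hpos.ne (hval ▸ integral_undef h).symm
  have hM : 0 ≤ M := (hf 0).trans (hfM 0)
  calc ∫ w, mehlerK t x w * f w
      ≤ ∫ w, (4 * π * t) ^ (-(3 : ℝ) / 2) * Real.exp (-(1 / (4 * t)) * ‖w - x‖ ^ 2) * M := by
        refine integral_mono_of_nonneg
          (.of_forall fun w ↦ mul_nonneg (mehlerK_nonneg ht x w) (hf w))
          ((hint.const_mul _).mul_const _) (.of_forall fun w ↦ ?_)
        have := mehlerK_nonneg ht x w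
        exact mul_le_mul (mehlerK_le_heatKernel ht x w) (hfM w) (hf w) (by positivity)
    _ = M := by
        rw [integral_mul_const, integral_const_mul, hval, neg_div,
          Real.rpow_neg (by positivity), inv_mul_cancel₀ (by positivity), one_mul]

lemma integral_mehlerK_mul_two_le {δ a b M : ℝ} (hδ0 : 0 < δ) (hδ : δ < 1 / 4)
    (ha : 0 < a) (hb : 0 < b) (p q : EuclideanSpace ℝ (Fin 3))
    {f : EuclideanSpace ℝ (Fin 3) → ℝ} (hf : ∀ w, 0 ≤ f w) (hfM : ∀ w, f w ≤ M) :
    ∫ w, mehlerK a p w * (mehlerK b q w * f w) ≤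
      a ^ (-(3 * δ)) * b ^ (-(3 : ℝ) / 2 + 3 * δ) * M := by
  have hM : 0 ≤ M := (hf 0).trans (hfM 0)
  have hbound {k l : ℝ} (hk : 0 < k) (hl : 0 < l) (x₁ x₂ : EuclideanSpace ℝ (Fin 3)) :
      ∫ w, mehlerK k x₁ w * (mehlerK l x₂ w * f w) ≤ l ^ (-(3 : ℝ) / 2) * M :=
    integral_mehlerK_mul_le hk x₁ (fun w ↦ mul_nonneg (mehlerK_nonneg hl x₂ w) (hf w))
      fun w ↦ mul_le_mul (mehlerK_le_rpow hl x₂ w) (hfM w) (hf w) (by positivity)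
  rcases le_total a b with h | h
  · refine (hbound ha hb p q).trans (mul_le_mul_of_nonneg_right ?_ hM)
    rw [Real.rpow_add hb, mul_left_comm, Real.rpow_neg ha.le, inv_mul_eq_div]
    refine le_mul_of_one_le_right (by positivity) ((one_le_div (by positivity)).2 ?_)
    gcongr
  · simp only [mul_left_comm (mehlerK a p _)]
    refine (hbound hb ha q p).trans (mul_le_mul_of_nonneg_right ?_ hM)
    rw [show -(3 : ℝ) / 2 = -(3 * δ) + (-(3 : ℝ) / 2 + 3 * δ) by ring, Real.rpow_add ha]
    gcongr ?_ * ?_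
    rw [show -(3 * δ) + (-(3 : ℝ) / 2 + 3 * δ) + 3 * δ = -(3 : ℝ) / 2 + 3 * δ by ring]
    exact Real.rpow_le_rpow_of_nonpos hb h (by linarith)

lemma integral_mehlerK_mul_four_le {δ a b c d : ℝ} (hδ0 : 0 < δ) (hδ : δ < 1 / 4)
    (ha : 0 < a) (hb : 0 < b) (hc : 0 < c) (hd : 0 < d)
    (p q r s : EuclideanSpace ℝ (Fin 3)) :
    ∫ w, mehlerK a p w * mehlerK b q w * mehlerK c r w * mehlerK d s w ≤
      a ^ (-(3 * δ)) * b ^ (-(3 : ℝ) / 2 + δ) * (c * d) ^ (-(3 : ℝ) / 2 + δ) := by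
  set I := ∫ w, mehlerK a p w * mehlerK b q w * mehlerK c r w * mehlerK d s w with hI
  set P := a ^ (-(3 : ℝ) / 2) * b ^ (-(3 : ℝ) / 2) * c ^ (-(3 : ℝ) / 2) * d ^ (-(3 : ℝ) / 2)
    with hP
  have hcancel {u : ℝ} (hu : 0 < u) : u ^ (-(3 : ℝ) / 2) * u ^ ((3 : ℝ) / 2) = 1 := by
    rw [← Real.rpow_add hu]; norm_num
  have hbound {k l m n : ℝ} (hk : 0 < k) (hl : 0 < l) (hm : 0 < m) (hn : 0 < n)
      (x₁ x₂ x₃ x₄ : EuclideanSpace ℝ (Fin 3)) :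
      ∫ w, mehlerK k x₁ w * (mehlerK l x₂ w * mehlerK m x₃ w * mehlerK n x₄ w) ≤
        l ^ (-(3 : ℝ) / 2) * m ^ (-(3 : ℝ) / 2) * n ^ (-(3 : ℝ) / 2) := by
    refine integral_mehlerK_mul_le hk x₁ (fun w ↦ ?_) (fun w ↦ ?_)
    all_goals
      have h₂ := mehlerK_nonneg hl x₂ w
      have h₃ := mehlerK_nonneg hm x₃ w
      have h₄ := mehlerK_nonneg hn x₄ w
    · positivity
    · gcongr
      exacts [mehlerK_le_rpow hl x₂ w, mehlerK_le_rpow hm x₃ w, mehlerK_le_rpow hn x₄ w]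
  have hIa : I ≤ P * a ^ ((3 : ℝ) / 2) := by
    convert hbound ha hb hc hd p q r s using 1
    · rw [hI]; congr 1; ext w; ring
    · rw [hP]; linear_combination (b ^ (-(3 : ℝ) / 2) * c ^ (-(3 : ℝ) / 2) *
        d ^ (-(3 : ℝ) / 2)) * hcancel ha
  have hIb : I ≤ P * b ^ ((3 : ℝ) / 2) := by
    convert hbound hb ha hc hd q p r s using 1
    · rw [hI]; congr 1; ext w; ring
    · rw [hP]; linear_combination (a ^ (-(3 : ℝ) / 2) * c ^ (-(3 : ℝ) / 2) *
        d ^ (-(3 : ℝ) / 2)) * hcancel hb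
  have hIc : I ≤ P * c ^ ((3 : ℝ) / 2) := by
    convert hbound hc ha hb hd r p q s using 1
    · rw [hI]; congr 1; ext w; ring
    · rw [hP]; linear_combination (a ^ (-(3 : ℝ) / 2) * b ^ (-(3 : ℝ) / 2) *
        d ^ (-(3 : ℝ) / 2)) * hcancel hc
  have hId : I ≤ P * d ^ ((3 : ℝ) / 2) := by
    convert hbound hd ha hb hc s p q r using 1
    · rw [hI]; congr 1; ext w; ring
    · rw [hP]; linear_combination (a ^ (-(3 : ℝ) / 2) * b ^ (-(3 : ℝ) / 2) *
        c ^ (-(3 : ℝ) / 2)) * hcancel hd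
  obtain ⟨m, hm, hma, hmb, hmc, hmd, hIm⟩ : ∃ m, 0 < m ∧ m ≤ a ∧ m ≤ b ∧ m ≤ c ∧ m ≤ d ∧
      I ≤ P * m ^ ((3 : ℝ) / 2) := by
    refine ⟨min (min a b) (min c d), by positivity, by simp, by simp, by simp, by simp, ?_⟩
    rcases min_choice (min a b) (min c d) with h | h <;> rw [h]
    · rcases min_choice a b with h | h <;> rwa [h]
    · rcases min_choice c d with h | h <;> rwa [h]
  have hsplit : m ^ ((3 : ℝ) / 2) = m ^ ((3 : ℝ) / 2 - 3 * δ) * m ^ δ * m ^ δ * m ^ δ := by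
    simp only [← Real.rpow_add hm]
    congr 1
    ring
  calc I ≤ P * m ^ ((3 : ℝ) / 2) := hIm
    _ ≤ P * (a ^ ((3 : ℝ) / 2 - 3 * δ) * b ^ δ * c ^ δ * d ^ δ) := by
        rw [hsplit]
        gcongr
        linarith
    _ = a ^ (-(3 * δ)) * b ^ (-(3 : ℝ) / 2 + δ) * (c * d) ^ (-(3 : ℝ) / 2 + δ) := by
        rw [hP, Real.mul_rpow hc.le hd.le,
          show -(3 * δ) = -(3 : ℝ) / 2 + (3 / 2 - 3 * δ) by ring, Real.rpow_add ha,
          Real.rpow_add hb, Real.rpow_add hc, Real.rpow_add hd]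
        ring

/-- a product-of-kernels integral bound (estimate on `ℱ^{1,2}`). -/
theorem kernel_product_bound_F12 (T : ℝ) (hT : 0 < T) (δ : ℝ) (hδ0 : 0 < δ) (hδ : δ < 1 / 4) :
    ∃ C : ℝ, 0 < C ∧
      ∀ t₁ t₂ s₁ s₂ η₁ η₂ τ₁ τ₂ : ℝ,
        0 < s₁ → s₁ < t₁ → t₁ ≤ T → 0 < s₂ → s₂ < t₂ → t₂ ≤ T →
        0 < η₁ → η₁ ≤ 2 * T + 2 → 0 < η₂ → η₂ ≤ 2 * T + 2 →
        0 < τ₁ → τ₁ ≤ 2 * T + 2 → 0 < τ₂ → τ₂ ≤ 2 * T + 2 →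
        ∀ y₁ y₂ z₁ z₂ : EuclideanSpace ℝ (Fin 3),
          (∫ w₁, ∫ w₂,
              mehlerK (t₁ - s₁) y₁ w₁ * mehlerK (t₂ - s₂) y₂ w₂ * mehlerK η₁ z₁ w₂ *
                mehlerK η₂ z₂ w₁ * mehlerK τ₁ w₁ w₂ * mehlerK τ₂ w₁ w₂) ≤
            C * (t₁ - s₁) ^ (-(3 * δ)) * (t₂ - s₂) ^ (-(3 * δ)) *
              η₁ ^ (-(3 : ℝ) / 2 + δ) * η₂ ^ (-(3 : ℝ) / 2 + 3 * δ) *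
                (τ₁ * τ₂) ^ (-(3 : ℝ) / 2 + δ) := by
  refine ⟨1, one_pos, ?_⟩
  intro t₁ t₂ s₁ s₂ η₁ η₂ τ₁ τ₂ _ h₁ _ _ h₂ _ hη₁ _ hη₂ _ hτ₁ _ hτ₂ _ y₁ y₂ z₁ z₂
  have ht₁ : 0 < t₁ - s₁ := sub_pos.2 h₁
  have ht₂ : 0 < t₂ - s₂ := sub_pos.2 h₂
  set B := (t₂ - s₂) ^ (-(3 * δ)) * η₁ ^ (-(3 : ℝ) / 2 + δ) *
    (τ₁ * τ₂) ^ (-(3 : ℝ) / 2 + δ) with hB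
  have hB0 : 0 ≤ B := by positivity
  set J : EuclideanSpace ℝ (Fin 3) → ℝ := fun w₁ ↦ ∫ w₂,
    mehlerK (t₂ - s₂) y₂ w₂ * mehlerK η₁ z₁ w₂ * mehlerK τ₁ w₁ w₂ * mehlerK τ₂ w₁ w₂ with hJ
  have hJ0 (w₁) : 0 ≤ J w₁ := integral_nonneg fun w₂ ↦
    mul_nonneg (mul_nonneg (mul_nonneg (mehlerK_nonneg ht₂ _ _) (mehlerK_nonneg hη₁ _ _))
      (mehlerK_nonneg hτ₁ _ _)) (mehlerK_nonneg hτ₂ _ _)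
  have hJB (w₁) : J w₁ ≤ B := integral_mehlerK_mul_four_le hδ0 hδ ht₂ hη₁ hτ₁ hτ₂ y₂ z₁ w₁ w₁
  calc _ = ∫ w₁, mehlerK (t₁ - s₁) y₁ w₁ * (mehlerK η₂ z₂ w₁ * J w₁) := by
        simp only [hJ, ← integral_const_mul]
        congr! 4
        ring
    _ ≤ (t₁ - s₁) ^ (-(3 * δ)) * η₂ ^ (-(3 : ℝ) / 2 + 3 * δ) * B :=
        integral_mehlerK_mul_two_le hδ0 hδ ht₁ hη₂ y₁ z₂ hJ0 hJB
    _ = _ := by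
        rw [hB]
        ring

end
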